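/- arXiv:math/0612746 — 2 statements merged into one kernel-verified Lean document; each statement's English description precedes it below -/
import Mathlib

section
/- Let V, W be finite directed graphs with no sinks and let φ : V → W be a surjective graph morphism with the path lifting property. Then the induced map φ̂ : X_V → X_W, (φ̂ p) n = φ¹(p n), between the infinite path spaces is continuous and open (with respect to the subspace topologies of the product topologies, the edge sets being discrete). -/
/-- If `b` is an infinite path starting with the image of `a 0, …, a n`, where `a` is an infinite
path, then `b` lifts to an infinite path starting with `a 0, …, a n`. -/
theorem exists_path_lift_extending {V0 V1 W0 W1 : Type*}
    {sV rV : V1 → V0} {sW rW : W1 → W0} {φ0 : V0 → W0} {φ1 : V1 → W1}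
    (hmor_r : ∀ e, rW (φ1 e) = φ0 (rV e))
    (hlift : ∀ v b, sW b = φ0 v → ∃ a, sV a = v ∧ φ1 a = b)
    {a : ℕ → V1} (ha : ∀ k, rV (a k) = sV (a (k + 1)))
    {b : ℕ → W1} (hb : ∀ k, rW (b k) = sW (b (k + 1)))
    {n : ℕ} (hab : ∀ k ≤ n, φ1 (a k) = b k) :
    ∃ c : ℕ → V1, (∀ k, rV (c k) = sV (c (k + 1))) ∧ (∀ k, φ1 (c k) = b k) ∧
      ∀ k ≤ n, c k = a k := by
  have step : ∀ k e, ∃ e', (φ1 e = b k → rV e = sV e' ∧ φ1 e' = b (k + 1)) ∧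
      (e = a k → k + 1 ≤ n → e' = a (k + 1)) := by
    intro k e
    by_cases hk : e = a k ∧ k + 1 ≤ n
    · obtain ⟨rfl, hk⟩ := hk
      exact ⟨a (k + 1), fun _ => ⟨ha k, hab _ hk⟩, fun _ _ => rfl⟩
    · by_cases he : φ1 e = b k
      · obtain ⟨e', hs, hφ⟩ := hlift (rV e) (b (k + 1)) (by rw [← hb, ← he, hmor_r])
        exact ⟨e', fun _ => ⟨hs.symm, hφ⟩, fun h₁ h₂ => absurd ⟨h₁, h₂⟩ hk⟩
      · exact ⟨e, fun h => absurd h he, fun h₁ h₂ => absurd ⟨h₁, h₂⟩ hk⟩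
  choose next hnext hnext_eq using step
  let c : ℕ → V1 := fun k => Nat.rec (a 0) next k
  have hc : ∀ k, φ1 (c k) = b k := by
    intro k
    induction k with
    | zero => exact hab 0 n.zero_le
    | succ k ih => exact (hnext k (c k) ih).2
  refine ⟨c, fun k => (hnext k (c k) (hc k)).1, hc, fun k hk => ?_⟩
  induction k with
  | zero => rfl
  | succ k ih => exact hnext_eq k (c k) (ih (by omega)) hk

/-- Let `φ = (φ0, φ1)` be a surjective graph morphism with the path lifting property
between finite directed graphs without sinks.  The induced map `φ̂` between the
infinite path spaces (subspaces of the product spaces of the discrete edge sets)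
is continuous and open. -/
theorem graph_morphism_induced_map_continuous_open
    {V0 V1 W0 W1 : Type} [Fintype V0] [Fintype V1] [Fintype W0] [Fintype W1]
    [TopologicalSpace V1] [DiscreteTopology V1]
    [TopologicalSpace W1] [DiscreteTopology W1]
    (sV rV : V1 → V0) (sW rW : W1 → W0)
    (hVnosink : ∀ v : V0, ∃ e : V1, sV e = v)
    (hWnosink : ∀ w : W0, ∃ e : W1, sW e = w)
    (φ0 : V0 → W0) (φ1 : V1 → W1)
    (hmor_s : ∀ e : V1, sW (φ1 e) = φ0 (sV e))
    (hmor_r : ∀ e : V1, rW (φ1 e) = φ0 (rV e))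
    (hsurj0 : Function.Surjective φ0) (hsurj1 : Function.Surjective φ1)
    (hlift : ∀ (v : V0) (b : W1), sW b = φ0 v → ∃ a : V1, sV a = v ∧ φ1 a = b)
    (φhat : {p : ℕ → V1 // ∀ n, rV (p n) = sV (p (n + 1))} →
            {q : ℕ → W1 // ∀ n, rW (q n) = sW (q (n + 1))})
    (hφhat : ∀ p n, (φhat p).1 n = φ1 (p.1 n)) :
    Continuous φhat ∧ IsOpenMap φhat := by
  constructor
  · refine Continuous.subtype_mk (f := fun p => (φhat p).1) (continuous_pi fun n => ?_) _
    simp only [hφhat]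
    exact continuous_of_discreteTopology.comp ((continuous_apply n).comp continuous_subtype_val)
  · rintro _ ⟨O, hO, rfl⟩
    rw [isOpen_iff_mem_nhds]
    rintro _ ⟨p, hp, rfl⟩
    obtain ⟨_, ⟨x, n, rfl⟩, hpx, hsub⟩ :=
      (PiNat.isTopologicalBasis_cylinders (fun _ : ℕ => V1)).exists_subset_of_mem_open hp hO
    have hcyl := (PiNat.isOpen_cylinder (fun _ : ℕ => W1) (φhat p).1 (n + 1)).preimage
      (continuous_subtype_val (p := fun q : ℕ → W1 => ∀ k, rW (q k) = sW (q (k + 1))))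
    refine Filter.mem_of_superset (hcyl.mem_nhds (PiNat.self_mem_cylinder _ _)) fun q hq => ?_
    obtain ⟨c, hc, hcq, hcp⟩ := exists_path_lift_extending hmor_r hlift p.2 q.2
      (n := n) fun k hk => by rw [← hφhat, hq k (by omega)]
    refine ⟨⟨c, hc⟩, hsub fun k hk => ?_, Subtype.ext (funext fun k => ?_)⟩
    · exact (hcp k hk.le).trans (hpx k hk)
    · rw [hφhat, hcq]
end

section
/- Let C be a groupoid, H a group, and π : C ⥤ SingleObj H a functor which is a covering, i.e., for every object x of C and every h ∈ H there is a unique pair (y, f : x ⟶ y) in C with π mapping f to h. Then there exists an action of H on the type of objects of C and an isomorphism of categories Φ : C ≅ ActionCategory H (objects of C) which is the identity on objects and satisfies ActionCategory.π ∘ Φ = π. -/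
open CategoryTheory

namespace CategoryTheory.SingleObjCovering

variable {C : Type*} [Groupoid C] {H : Type*} [Group H] (π : C ⥤ SingleObj H)

/-- The group element labelling a morphism over a one-object groupoid. -/
def label {x y : C} (f : x ⟶ y) : H := π.map f

theorem label_id (x : C) : label π (𝟙 x) = 1 := π.map_id x

theorem label_comp {x y z : C} (f : x ⟶ y) (g : y ⟶ z) :
    label π (f ≫ g) = label π g * label π f := π.map_comp f g

variable {π}

theorem label_injective
    (hcov : ∀ (x : C) (h : H), ∃! p : (y : C) × (x ⟶ y), label π p.2 = h) {x y : C}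
    {f g : x ⟶ y} (hfg : label π f = label π g) : f = g :=
  eq_of_heq (Sigma.mk.inj ((hcov x _).unique (y₁ := ⟨y, f⟩) (y₂ := ⟨y, g⟩) hfg rfl)).2

variable (hcov : ∀ (x : C) (h : H), ∃! p : (y : C) × (x ⟶ y), label π p.2 = h)

/-- The endpoint of the unique lift of `h` starting at `x`. -/
noncomputable def endpoint (h : H) (x : C) : C := (hcov x h).choose.1

theorem endpoint_label {x y : C} (f : x ⟶ y) : endpoint hcov (label π f) x = y :=
  congrArg Sigma.fst ((hcov x _).unique (y₂ := ⟨y, f⟩) (hcov x _).choose_spec.1 rfl)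

theorem exists_label_eq {x y : C} {h : H} (hxy : endpoint hcov h x = y) :
    ∃ f : x ⟶ y, label π f = h := by
  subst hxy
  exact ⟨(hcov x h).choose.2, (hcov x h).choose_spec.1⟩

/-- The action of the base group on the objects of a covering, by unique lifting. -/
@[reducible]
noncomputable def mulAction : MulAction H C where
  smul := endpoint hcov
  one_smul x := (congrArg (endpoint hcov · x) (label_id π x)).symm.trans (endpoint_label hcov _)
  mul_smul h k x := by
    obtain ⟨f, hf⟩ := exists_label_eq hcov (h := k) (x := x) rfl
    obtain ⟨g, hg⟩ := exists_label_eq hcov (h := h) (x := endpoint hcov k x) rfl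
    have hfg := endpoint_label hcov (f ≫ g)
    rwa [label_comp, hf, hg] at hfg

/-- The functor from a covering to the associated action groupoid. -/
noncomputable def toActionCategory :
    letI := mulAction hcov
    C ⥤ ActionCategory H C :=
  letI := mulAction hcov
  { obj := fun x => (x : ActionCategory H C)
    map := fun f => ⟨label π f, endpoint_label hcov f⟩
    map_id := fun x => Subtype.ext (label_id π x)
    map_comp := fun f g => Subtype.ext (label_comp π f g) }

/-- The functor from the action groupoid to the covering, by unique lifting. -/
noncomputable def ofActionCategory :
    letI := mulAction hcov
    ActionCategory H C ⥤ C :=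
  letI := mulAction hcov
  { obj := fun x => x.back
    map := fun f => (exists_label_eq hcov f.2).choose
    map_id := fun x => label_injective hcov <|
      (exists_label_eq hcov (𝟙 x : x ⟶ x).2).choose_spec.trans (label_id π _).symm
    map_comp := fun f g => label_injective hcov <|
      (exists_label_eq hcov (f ≫ g).2).choose_spec.trans <| Eq.symm <|
        (label_comp π _ _).trans <| congrArg₂ (· * ·)
          (exists_label_eq hcov g.2).choose_spec (exists_label_eq hcov f.2).choose_spec }

theorem label_ofActionCategory_map :
    letI := mulAction hcov
    ∀ {x y : ActionCategory H C} (f : x ⟶ y),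
      label π ((ofActionCategory hcov).map f) = f.val :=
  fun f => (exists_label_eq hcov f.2).choose_spec

theorem toActionCategory_comp_ofActionCategory :
    letI := mulAction hcov
    toActionCategory hcov ⋙ ofActionCategory hcov = 𝟭 C :=
  letI := mulAction hcov
  Functor.hext (fun _ => rfl) fun _ _ _ =>
    heq_of_eq (label_injective hcov (label_ofActionCategory_map hcov _))

theorem ofActionCategory_comp_toActionCategory :
    letI := mulAction hcov
    ofActionCategory hcov ⋙ toActionCategory hcov = 𝟭 (ActionCategory H C) :=
  letI := mulAction hcov
  Functor.hext (fun _ => rfl) fun _ _ f =>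
    heq_of_eq (Subtype.ext (label_ofActionCategory_map hcov f))

end CategoryTheory.SingleObjCovering

/-- Every covering of a group by a groupoid arises from an action: if `C` is a groupoid
and `π : C ⥤ SingleObj H` is a covering functor (unique lifting of morphisms with
prescribed source), then there is an action of `H` on the objects of `C` and an
isomorphism of categories `Φ : C ≅ ActionCategory H C` which is the identity on
objects and satisfies `Φ ⋙ ActionCategory.π H C = π`. -/
theorem covering_of_group_is_action_groupoid
    {C : Type*} [Groupoid C] {H : Type*} [Group H] (π : C ⥤ SingleObj H)
    (hcov : ∀ (x : C) (h : H),
      ∃! p : (y : C) × (x ⟶ y), π.map p.2 = h) :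
    ∃ m : MulAction H C, by
      letI := m
      exact ∃ (Φ : C ⥤ ActionCategory H C) (Ψ : ActionCategory H C ⥤ C),
        Φ ⋙ Ψ = 𝟭 C ∧ Ψ ⋙ Φ = 𝟭 (ActionCategory H C) ∧
        (∀ x : C, (Φ.obj x).back = x) ∧
        Φ ⋙ ActionCategory.π H C = π := by
  exact ⟨SingleObjCovering.mulAction hcov, SingleObjCovering.toActionCategory hcov,
    SingleObjCovering.ofActionCategory hcov,
    SingleObjCovering.toActionCategory_comp_ofActionCategory hcov,
    SingleObjCovering.ofActionCategory_comp_toActionCategory hcov, fun _ => rfl,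
    Functor.hext (fun _ => rfl) fun _ _ _ => HEq.rfl⟩
end
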